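/- (Proposition 4.1) Let F be a finite set of features with model π, instance v and similarity relations as above, and let ν_a(S) = 1 if S is a WAXp and 0 otherwise. If i ∈ F is an irrelevant feature (belongs to no AXp), then for every S ⊆ F\{i}, ν_a(S ∪ {i}) = ν_a(S). -/

import Mathlib

open Finset

/-- A set `S` of features is a weak abductive explanation (WAXp): for every point `x`
of feature space, if `x` is similar to `v` on all features in `S`, then the model
output at `x` is similar to the output at `v`. -/
def WAXp {m : ℕ} {D : Fin m → Type*} {T : Type*}
    (π : (∀ i, D i) → T) (v : ∀ i, D i)
    (simD : ∀ i, D i → D i → Prop) (simT : T → T → Prop)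
    (S : Finset (Fin m)) : Prop :=
  ∀ x : ∀ i, D i, (∀ i ∈ S, simD i (x i) (v i)) → simT (π x) (π v)

/-- An AXp is a subset-minimal WAXp. -/
def AXp {m : ℕ} {D : Fin m → Type*} {T : Type*}
    (π : (∀ i, D i) → T) (v : ∀ i, D i)
    (simD : ∀ i, D i → D i → Prop) (simT : T → T → Prop)
    (S : Finset (Fin m)) : Prop :=
  WAXp π v simD simT S ∧ ∀ S' ⊂ S, ¬ WAXp π v simD simT S'

/-- The characteristic function `ν_a`: takes value 1 on WAXps and 0 otherwise. -/
noncomputable def nuA {m : ℕ} {D : Fin m → Type*} {T : Type*}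
    (π : (∀ i, D i) → T) (v : ∀ i, D i)
    (simD : ∀ i, D i → D i → Prop) (simT : T → T → Prop)
    (S : Finset (Fin m)) : ℝ := by
  classical exact if WAXp π v simD simT S then 1 else 0

/-- Supersets of WAXps are WAXps. -/
theorem WAXp.mono {m : ℕ} {D : Fin m → Type*} {T : Type*}
    {π : (∀ i, D i) → T} {v : ∀ i, D i}
    {simD : ∀ i, D i → D i → Prop} {simT : T → T → Prop}
    {S S' : Finset (Fin m)} (h : WAXp π v simD simT S) (hS : S ⊆ S') :
    WAXp π v simD simT S' :=
  fun x hx => h x fun i hi => hx i (hS hi)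

/-- Every WAXp contains an AXp. -/
theorem WAXp.exists_AXp_subset {m : ℕ} {D : Fin m → Type*} {T : Type*}
    {π : (∀ i, D i) → T} {v : ∀ i, D i}
    {simD : ∀ i, D i → D i → Prop} {simT : T → T → Prop}
    {S : Finset (Fin m)} (h : WAXp π v simD simT S) :
    ∃ A ⊆ S, AXp π v simD simT A := by
  obtain ⟨A, hAS, hA⟩ := exists_minimal_le_of_wellFoundedLT (WAXp π v simD simT) S h
  exact ⟨A, hAS, hA.prop, fun S' hS' => hA.not_prop_of_lt hS'⟩

/-- Proposition 4.1: if feature `i` is irrelevant (belongs to no AXp),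
then for every `S ⊆ F \ {i}`, `ν_a (S ∪ {i}) = ν_a S`. -/
theorem irrelevant_nuA_unchanged {m : ℕ} {D : Fin m → Type*} {T : Type*}
    (π : (∀ i, D i) → T) (v : ∀ i, D i)
    (simD : ∀ i, D i → D i → Prop) (simT : T → T → Prop)
    (i : Fin m)
    (hirr : ¬ ∃ A : Finset (Fin m), AXp π v simD simT A ∧ i ∈ A) :
    ∀ S : Finset (Fin m), i ∉ S →
      nuA π v simD simT (insert i S) = nuA π v simD simT S := by
  intro S _
  have hiff : WAXp π v simD simT (insert i S) ↔ WAXp π v simD simT S := by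
    refine ⟨fun h => ?_, fun h => h.mono (subset_insert i S)⟩
    obtain ⟨A, hAS, hA⟩ := h.exists_AXp_subset
    have hiA : i ∉ A := fun hi => hirr ⟨A, hA, hi⟩
    exact hA.1.mono ((subset_insert_iff_of_notMem hiA).1 hAS)
  classical exact if_congr hiff rfl rfl
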